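/- arXiv:2302.01869 — 2 statements merged into one kernel-verified Lean document; each statement's English description precedes it below -/
import Mathlib

section
/- For every transmission parameter t ∈ [0,1], every local field D (diagonal unitary on H), every N ∈ ℤ⁺, and every unit vector Ψ₀ supported on span{δ₀, δ₁}, the quantum walk U_{t,D} = D·U_t satisfies (1/N)·⟨X⟩_{U_{t,D}^N Ψ₀} ≤ (1/N)·‖[X, U_{t,D}^N]‖ ≤ t. -/
noncomputable section

abbrev Hqw : Type := lp (fun _ : ℤ => ℂ) 2
abbrev Op : Type := Hqw →L[ℂ] Hqw

noncomputable def δ (j : ℤ) : Hqw := lp.single 2 j 1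

def coord (ψ : Hqw) (i : ℤ) : ℂ := ψ i

/-- `B δ_j = δ_{j-1} - δ_{j+1}`. -/
def IsB (B : Op) : Prop := ∀ j : ℤ, B (δ j) = δ (j - 1) - δ (j + 1)

/-- `C δ_{2j} = δ_{2j+2}`, `C δ_{2j+1} = δ_{2j-1}`. -/
def IsC (C : Op) : Prop :=
  ∀ j : ℤ, C (δ (2 * j)) = δ (2 * j + 2) ∧ C (δ (2 * j + 1)) = δ (2 * j - 1)

/-- the position sequence: `x_{2j} = x_{2j+1} = |j|`. -/
def IsPos (x : ℤ → ℝ) : Prop :=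
  ∀ j : ℤ, x (2 * j) = |(j : ℝ)| ∧ x (2 * j + 1) = |(j : ℝ)|

/-- `K` is the commutator `[X, A]`, i.e. `⟨δ_i, K δ_j⟩ = (x_i - x_j) ⟨δ_i, A δ_j⟩`. -/
def IsXComm (x : ℤ → ℝ) (A K : Op) : Prop :=
  ∀ i j : ℤ, coord (K (δ j)) i = ((x i - x j : ℝ) : ℂ) * coord (A (δ j)) i

/-- a local field: a diagonal unitary `D δ_j = e^{iθ_j} δ_j`. -/
def IsLocalField (D : Op) : Prop :=
  ∃ θ : ℤ → ℝ, ∀ j : ℤ, D (δ j) = Complex.exp ((θ j : ℂ) * Complex.I) • δ j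

/-- `U_t = r² I + r t B + t² C` with `r = √(1 - t²)`. -/
def Ut (t : ℝ) (B C : Op) : Op :=
  (((Real.sqrt (1 - t ^ 2)) ^ 2 : ℝ) : ℂ) • (1 : Op) +
    ((Real.sqrt (1 - t ^ 2) * t : ℝ) : ℂ) • B + ((t ^ 2 : ℝ) : ℂ) • C

/-- `⟨X⟩_ψ = Σ_j x_j |⟨δ_j, ψ⟩|²`. -/
def Xexp (x : ℤ → ℝ) (ψ : Hqw) : ℝ := ∑' j : ℤ, x j * ‖coord ψ j‖ ^ 2

/-- a unit vector supported on `span{δ₀, δ₁}`. -/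
def IsInit (Ψ : Hqw) : Prop := ‖Ψ‖ = 1 ∧ ∃ a b : ℂ, Ψ = a • δ 0 + b • δ 1

/-- `α = e^{2πik/n}` with `k ∈ ℤ⁺`, `gcd(k,n) = 1`, `α ≠ 1`. -/
def IsAdmissible (n : ℕ) (α : ℂ) : Prop :=
  α ≠ 1 ∧ ∃ k : ℕ, 0 < k ∧ Nat.gcd k n = 1 ∧
    α = Complex.exp (((2 * Real.pi * k / n : ℝ) : ℂ) * Complex.I)

/-- the `n`-periodic field `D_n δ_j = α^j δ_j`. -/
def IsDn (α : ℂ) (D : Op) : Prop := ∀ j : ℤ, D (δ j) = α ^ j • δ j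

/-- `B^{(j)} = D_n^j B D_n^{-j}`, explicitly `B^{(j)} δ_i = α^{-j} δ_{i-1} - α^{j} δ_{i+1}`. -/
def IsBj (α : ℂ) (j : ℤ) (Bj : Op) : Prop :=
  ∀ i : ℤ, Bj (δ i) = α ^ (-j) • δ (i - 1) - α ^ j • δ (i + 1)

/-- `C^{(j)} = D_n^j C D_n^{-j}`, explicitly `C^{(j)} δ_{2i} = α^{2j} δ_{2i+2}`,
`C^{(j)} δ_{2i+1} = α^{-2j} δ_{2i-1}`. -/
def IsCj (α : ℂ) (j : ℤ) (Cj : Op) : Prop :=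
  ∀ i : ℤ, Cj (δ (2 * i)) = α ^ (2 * j) • δ (2 * i + 2) ∧
    Cj (δ (2 * i + 1)) = α ^ (-(2 * j)) • δ (2 * i - 1)

-- the elementary symmetric polynomial of operators `S^{ℓ,m}_{[a, n-1]}`:
-- sum over `a ≤ j₁ < … < j_ℓ ≤ n-1` and `η ∈ {0,1}^ℓ` with `|η| = m` of the ordered
-- products `A_{η₁}^{(j₁)} ⋯ A_{η_ℓ}^{(j_ℓ)}`, where `A_1 = C`, `A_0 = B`.
open Classical in
noncomputable def Sop (Bf Cf : ℤ → Op) (a n ℓ m : ℕ) : Op :=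
  ∑ p : (Fin ℓ → Fin n) × (Fin ℓ → Bool),
    if StrictMono p.1 ∧ (∀ k, a ≤ (p.1 k : ℕ)) ∧
        (Finset.univ.filter fun k => p.2 k = true).card = m then
      (List.ofFn fun k : Fin ℓ =>
        if p.2 k = true then Cf ((p.1 k : ℕ) : ℤ) else Bf ((p.1 k : ℕ) : ℤ)).prod
    else 0

open Finsupp in
/-- inclusion of finitely supported vectors -/
def iot : (ℤ →₀ ℂ) →ₗ[ℂ] Hqw := Finsupp.linearCombination ℂ δ

def ee (j : ℤ) : ℤ →₀ ℂ := Finsupp.single j 1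

def ext (v : ℤ → (ℤ →₀ ℂ)) : (ℤ →₀ ℂ) →ₗ[ℂ] (ℤ →₀ ℂ) := Finsupp.linearCombination ℂ v

lemma ext_ee (v : ℤ → (ℤ →₀ ℂ)) (j : ℤ) : ext v (ee j) = v j := by
  simp [ext, ee]

lemma iot_ee (j : ℤ) : iot (ee j) = δ j := by
  simp [iot, ee]

lemma hom_ext' {M : Type*} [AddCommMonoid M] [Module ℂ M] (S T : (ℤ →₀ ℂ) →ₗ[ℂ] M)
    (h : ∀ j, S (ee j) = T (ee j)) : S = T := by
  apply Finsupp.lhom_ext'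
  intro j
  apply LinearMap.ext_ring
  simpa [ee] using h j

lemma coord_δ (j i : ℤ) : coord (δ j) i = if i = j then 1 else 0 := by
  simp [coord, δ, lp.single_apply, Pi.single_apply]

def coordL (i : ℤ) : Hqw →ₗ[ℂ] ℂ where
  toFun ψ := coord ψ i
  map_add' a b := by simp [coord]
  map_smul' a b := by simp [coord]

lemma coord_iot (f : ℤ →₀ ℂ) (i : ℤ) : coord (iot f) i = f i := by
  have : (coordL i).comp iot = Finsupp.lapply i := by
    apply hom_ext'
    intro j
    simp only [LinearMap.comp_apply, iot_ee, Finsupp.lapply_apply]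
    change coord (δ j) i = _
    rw [coord_δ, ee, Finsupp.single_apply]
    simp [eq_comm]
  exact congrArg (fun L => L f) this

lemma inner_δ (i j : ℤ) : inner ℂ (δ i) (δ j) = if i = j then (1 : ℂ) else 0 := by
  have : inner ℂ (δ i) (δ j) = coord (δ j) i := by
    rw [δ, lp.inner_single_left]; simp [coord]
  rw [this, coord_δ]

lemma inner_δ_ne (i j : ℤ) (h : i ≠ j) : inner ℂ (δ i) (δ j) = (0 : ℂ) := by
  rw [inner_δ, if_neg h]

lemma inner_δ_eq (i j : ℤ) (h : i = j) : inner ℂ (δ i) (δ j) = (1 : ℂ) := by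
  rw [inner_δ, if_pos h]

lemma ee_span (f : ℤ →₀ ℂ) {p : (ℤ →₀ ℂ) → Prop} (h0 : p 0)
    (ha : ∀ f g, p f → p g → p (f + g)) (hs : ∀ (c : ℂ) j, p (c • ee j)) : p f := by
  refine Finsupp.induction_linear f h0 ha ?_
  intro a b
  have := hs b a
  simpa [ee] using this

lemma gram (T : (ℤ →₀ ℂ) →ₗ[ℂ] Hqw) (c : ℝ) (hc : 0 ≤ c)
    (h : ∀ i j, inner ℂ (T (ee i)) (T (ee j)) = if i = j then ((c ^ 2 : ℝ) : ℂ) else 0)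
    (φ : ℤ →₀ ℂ) : ‖T φ‖ = c * ‖iot φ‖ := by
  have key : ∀ f g, inner ℂ (T f) (T g) = ((c ^ 2 : ℝ) : ℂ) * inner ℂ (iot f) (iot g) := by
    intro f g
    refine ee_span (p := fun f => inner ℂ (T f) (T g) = ((c ^ 2 : ℝ) : ℂ) * inner ℂ (iot f) (iot g)) f ?_ ?_ ?_
    · simp
    · intro f1 f2 h1 h2
      simp only [map_add, inner_add_left, h1, h2]; ring
    intro a i
    refine ee_span (p := fun g => inner ℂ (T (a • ee i)) (T g) = ((c ^ 2 : ℝ) : ℂ) *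
      inner ℂ (iot (a • ee i)) (iot g)) g ?_ ?_ ?_
    · simp
    · intro f1 f2 h1 h2
      simp only [map_add, inner_add_right, h1, h2]; ring
    intro b j
    simp only [map_smul, inner_smul_left, inner_smul_right, h, iot_ee, inner_δ]
    split_ifs <;> ring
  have h2 := key φ φ
  rw [inner_self_eq_norm_sq_to_K, inner_self_eq_norm_sq_to_K] at h2
  have h3 : ‖T φ‖ ^ 2 = (c * ‖iot φ‖) ^ 2 := by
    rw [mul_pow]
    apply Complex.ofReal_injective
    push_cast
    push_cast at h2
    exact h2
  exact (pow_left_inj₀ (norm_nonneg _) (by positivity) two_ne_zero).1 h3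

lemma op_bound (K : Op) (M : ℝ) (hM : 0 ≤ M) (h : ∀ f, ‖K (iot f)‖ ≤ M * ‖iot f‖) : ‖K‖ ≤ M := by
  refine K.opNorm_le_bound hM fun ψ => ?_
  have hs : HasSum (fun i => lp.single (E := fun _ : ℤ => ℂ) 2 i (ψ i)) ψ :=
    lp.hasSum_single (by simp) ψ
  have h1 : Filter.Tendsto (fun s : Finset ℤ => ∑ i ∈ s, lp.single (E := fun _ : ℤ => ℂ) 2 i (ψ i))
    Filter.atTop (nhds ψ) := hs
  refine le_of_tendsto_of_tendsto' ((K.continuous.tendsto ψ).comp h1).norm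
    (h1.norm.const_mul M) fun s => ?_
  have : (∑ i ∈ s, lp.single (E := fun _ : ℤ => ℂ) 2 i (ψ i)) = iot (∑ i ∈ s, ψ i • ee i) := by
    rw [map_sum]
    refine Finset.sum_congr rfl fun i _ => ?_
    rw [map_smul, iot_ee, δ, ← lp.single_smul]
    simp
  simp only [Function.comp, this]
  exact h _

/-- the multiplication operator -/
def Xf (x : ℤ → ℝ) : Module.End ℂ (ℤ →₀ ℂ) := ext fun j => (x j : ℂ) • ee j

lemma Xf_apply (x : ℤ → ℝ) (f : ℤ →₀ ℂ) (i : ℤ) : Xf x f i = x i * f i := by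
  refine ee_span (p := fun f => Xf x f i = x i * f i) f ?_ ?_ ?_
  · simp
  · intro f g h1 h2
    simp [h1, h2, mul_add]
  intro c j
  rw [Xf, map_smul, ext_ee]
  simp only [ee, Finsupp.smul_apply, Finsupp.single_apply, smul_eq_mul]
  split_ifs with h
  · subst h; ring
  · simp

def Uf (t : ℝ) : Module.End ℂ (ℤ →₀ ℂ) := ext fun j =>
  (((Real.sqrt (1 - t ^ 2)) ^ 2 : ℝ) : ℂ) • ee j +
    ((Real.sqrt (1 - t ^ 2) * t : ℝ) : ℂ) • (ee (j - 1) - ee (j + 1)) +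
      ((t ^ 2 : ℝ) : ℂ) • (if Even j then ee (j + 2) else ee (j - 2))

lemma Uf_even (t : ℝ) (j : ℤ) : Uf t (ee (2 * j)) = (((Real.sqrt (1 - t ^ 2)) ^ 2 : ℝ) : ℂ) • ee (2 * j) +
    ((Real.sqrt (1 - t ^ 2) * t : ℝ) : ℂ) • (ee (2 * j - 1) - ee (2 * j + 1)) +
      ((t ^ 2 : ℝ) : ℂ) • ee (2 * j + 2) := by
  rw [Uf, ext_ee, if_pos (by simp)]

lemma Uf_odd (t : ℝ) (j : ℤ) : Uf t (ee (2 * j + 1)) =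
    (((Real.sqrt (1 - t ^ 2)) ^ 2 : ℝ) : ℂ) • ee (2 * j + 1) +
    ((Real.sqrt (1 - t ^ 2) * t : ℝ) : ℂ) • (ee (2 * j) - ee (2 * j + 2)) +
      ((t ^ 2 : ℝ) : ℂ) • ee (2 * j - 1) := by
  rw [Uf, ext_ee, if_neg (by simp [parity_simps])]
  ring_nf

lemma even_odd (p : ℤ → Prop) (h0 : ∀ j, p (2 * j)) (h1 : ∀ j, p (2 * j + 1)) (i : ℤ) : p i := by
  rcases Int.even_or_odd' i with ⟨k, rfl | rfl⟩
  · exact h0 k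
  · exact h1 k

lemma iot_Uf (t : ℝ) (B C : Op) (hB : IsB B) (hC : IsC C) (f : ℤ →₀ ℂ) :
    Ut t B C (iot f) = iot (Uf t f) := by
  have : (Ut t B C).toLinearMap.comp iot = iot.comp (Uf t) := by
    apply hom_ext'
    refine even_odd _ ?_ ?_
    · intro j
      simp only [LinearMap.comp_apply, Uf_even, map_add, map_sub, map_smul, iot_ee]
      simp [Ut, hB (2 * j), (hC j).1]
    · intro j
      simp only [LinearMap.comp_apply, Uf_odd, map_add, map_sub, map_smul, iot_ee]
      have := hB (2 * j + 1)
      rw [show 2 * j + 1 - 1 = 2 * j by ring, show 2 * j + 1 + 1 = 2 * j + 2 by ring] at this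
      simp [Ut, this, (hC j).2]
  exact congrArg (fun L => L f) this

lemma norm_Uf (t : ℝ) (ht : t ∈ Set.Icc (0 : ℝ) 1) (f : ℤ →₀ ℂ) : ‖iot (Uf t f)‖ = ‖iot f‖ := by
  have hr : (Real.sqrt (1 - t ^ 2)) ^ 2 = 1 - t ^ 2 := Real.sq_sqrt (by nlinarith [ht.1, ht.2])
  have := gram (iot.comp (Uf t)) 1 zero_le_one ?_ f
  · simpa using this
  generalize hrr : Real.sqrt (1 - t ^ 2) = r at hr
  have hr' : (r : ℂ) ^ 2 = 1 - (t : ℂ) ^ 2 := by exact_mod_cast hr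
  refine even_odd _ (fun a => ?_) (fun a => ?_) <;> refine even_odd _ (fun b => ?_) (fun b => ?_) <;>
  simp only [LinearMap.comp_apply, Uf_even, Uf_odd, map_add, map_sub, map_smul, iot_ee, hrr,
    inner_add_left, inner_add_right, inner_sub_left, inner_sub_right, inner_smul_left,
    inner_smul_right, Complex.conj_ofReal]
  all_goals
    obtain h | h | h | h | h | h : b = a - 2 ∨ b = a - 1 ∨ b = a ∨ b = a + 1 ∨ b = a + 2 ∨ (b < a - 2 ∨ a + 2 < b) := by omega
  all_goals first
    | (subst h
       simp (disch := omega) only [inner_δ_ne, inner_δ_eq, if_pos, if_neg]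
       push_cast
       first
         | ring1
         | (linear_combination ((r : ℂ) ^ 2 + 1 + (t : ℂ) ^ 2) * hr')
       done)
    | (simp (disch := omega) only [inner_δ_ne, if_neg]
       ring)

/-- commutator of `X` and `U_t` -/
def Vf (x : ℤ → ℝ) (t : ℝ) : Module.End ℂ (ℤ →₀ ℂ) := Xf x * Uf t - Uf t * Xf x

lemma Xf_ee (x : ℤ → ℝ) (j : ℤ) : Xf x (ee j) = (x j : ℂ) • ee j := by rw [Xf, ext_ee]

lemma Vf_even (x : ℤ → ℝ) (hx : IsPos x) (t : ℝ) (j : ℤ) :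
    Vf x t (ee (2 * j)) =
      ((Real.sqrt (1 - t ^ 2) * t * (-(x (2 * j) - x (2 * (j - 1)))) : ℝ) : ℂ) • ee (2 * j - 1) +
      ((t ^ 2 * (x (2 * (j + 1)) - x (2 * j)) : ℝ) : ℂ) • ee (2 * j + 2) := by
  have h1 : x (2 * j + 1) = x (2 * j) := by rw [(hx j).1, (hx j).2]
  have h2 : x (2 * j - 1) = x (2 * (j - 1)) := by
    rw [(hx _).1, ← (hx _).2]; congr 1; ring
  have h3 : x (2 * j + 2) = x (2 * (j + 1)) := by congr 1; ring
  simp only [Vf, LinearMap.sub_apply, Module.End.mul_apply, Xf_ee, map_smul, Uf_even, map_add,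
    map_sub, h1, h2, h3]
  push_cast
  module

lemma Vf_odd (x : ℤ → ℝ) (hx : IsPos x) (t : ℝ) (j : ℤ) :
    Vf x t (ee (2 * j + 1)) =
      ((t ^ 2 * (-(x (2 * j) - x (2 * (j - 1)))) : ℝ) : ℂ) • ee (2 * j - 1) +
      ((-(Real.sqrt (1 - t ^ 2) * t) * (x (2 * (j + 1)) - x (2 * j)) : ℝ) : ℂ) • ee (2 * j + 2) := by
  have h1 : x (2 * j + 1) = x (2 * j) := by rw [(hx j).1, (hx j).2]
  have h2 : x (2 * j - 1) = x (2 * (j - 1)) := by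
    rw [(hx _).1, ← (hx _).2]; congr 1; ring
  have h3 : x (2 * j + 2) = x (2 * (j + 1)) := by congr 1; ring
  simp only [Vf, LinearMap.sub_apply, Module.End.mul_apply, Xf_ee, map_smul, Uf_odd, map_add,
    map_sub, h1, h2, h3]
  push_cast
  module

lemma step_sq (x : ℤ → ℝ) (hx : IsPos x) (j : ℤ) : (x (2 * (j + 1)) - x (2 * j)) ^ 2 = 1 := by
  rw [(hx _).1, (hx _).1]
  rcases le_or_gt 0 j with h | h
  · have : (0 : ℝ) ≤ j := by exact_mod_cast h
    push_cast
    rw [abs_of_nonneg this, abs_of_nonneg (by linarith)]; ring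
  · have : (j : ℝ) + 1 ≤ 0 := by exact_mod_cast h
    push_cast
    rw [abs_of_nonpos this, abs_of_nonpos (by linarith)]; ring

lemma norm_Vf (x : ℤ → ℝ) (hx : IsPos x) (t : ℝ) (ht : t ∈ Set.Icc (0 : ℝ) 1) (f : ℤ →₀ ℂ) :
    ‖iot (Vf x t f)‖ = t * ‖iot f‖ := by
  have hr : (Real.sqrt (1 - t ^ 2)) ^ 2 = 1 - t ^ 2 := Real.sq_sqrt (by nlinarith [ht.1, ht.2])
  refine gram (iot.comp (Vf x t)) t ht.1 ?_ f
  generalize hrr : Real.sqrt (1 - t ^ 2) = r at hr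
  have hr' : (r : ℂ) ^ 2 = 1 - (t : ℂ) ^ 2 := by exact_mod_cast hr
  refine even_odd _ (fun a => ?_) (fun a => ?_) <;> refine even_odd _ (fun b => ?_) (fun b => ?_) <;>
  simp only [LinearMap.comp_apply, Vf_even x hx, Vf_odd x hx, map_add, map_smul, iot_ee, hrr,
    inner_add_left, inner_add_right, inner_smul_left,
    inner_smul_right, Complex.conj_ofReal]
  all_goals
    rcases eq_or_ne b a with h | h
  all_goals first
    | (subst h
       have h1 := step_sq x hx b
       have h2 := step_sq x hx (b - 1)
       rw [sub_add_cancel] at h2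
       generalize x (2 * (b + 1)) - x (2 * b) = p at *
       generalize x (2 * b) - x (2 * (b - 1)) = q at *
       have h1' : (p : ℂ) ^ 2 = 1 := by exact_mod_cast h1
       have h2' : (q : ℂ) ^ 2 = 1 := by exact_mod_cast h2
       simp (disch := omega) only [inner_δ_ne, inner_δ_eq, if_pos, if_neg]
       push_cast
       first
         | linear_combination (t : ℂ) ^ 2 * hr' + r ^ 2 * t ^ 2 * h2' + t ^ 4 * h1'
         | linear_combination (t : ℂ) ^ 2 * hr' + r ^ 2 * t ^ 2 * h1' + t ^ 4 * h2'
         | linear_combination (r : ℂ) * t ^ 3 * (h2' - h1')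
       done)
    | (simp (disch := omega) only [inner_δ_ne, if_neg]
       ring)

/-- local field on finitely supported vectors -/
def Df (θ : ℤ → ℝ) : Module.End ℂ (ℤ →₀ ℂ) :=
  ext fun j => Complex.exp ((θ j : ℂ) * Complex.I) • ee j

lemma norm_Df (θ : ℤ → ℝ) (f : ℤ →₀ ℂ) : ‖iot (Df θ f)‖ = ‖iot f‖ := by
  have := gram (iot.comp (Df θ)) 1 zero_le_one ?_ f
  · simpa using this
  intro i j
  simp only [LinearMap.comp_apply, Df, ext_ee, map_smul, iot_ee, inner_smul_left, inner_smul_right,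
    inner_δ]
  split_ifs with h
  · subst h
    rw [← Complex.exp_conj, ← mul_assoc, ← Complex.exp_add]
    simp
  · simp

lemma Xf_Df (x θ : ℤ → ℝ) : Xf x * Df θ = Df θ * Xf x := by
  apply hom_ext'
  intro j
  simp only [Module.End.mul_apply, Xf_ee, Df, ext_ee, map_smul]
  rw [smul_comm]

lemma comm_bound (x : ℤ → ℝ) (W : Module.End ℂ (ℤ →₀ ℂ)) (t : ℝ)
    (hW : ∀ f, ‖iot (W f)‖ = ‖iot f‖)
    (hV : ∀ f, ‖iot ((Xf x * W - W * Xf x) f)‖ ≤ t * ‖iot f‖) (n : ℕ) :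
    (∀ f, ‖iot ((W ^ n) f)‖ = ‖iot f‖) ∧
    ∀ f, ‖iot ((Xf x * W ^ n - W ^ n * Xf x) f)‖ ≤ n * t * ‖iot f‖ := by
  induction n with
  | zero => simp
  | succ n ih =>
    constructor
    · intro f
      rw [pow_succ, Module.End.mul_apply, ih.1, hW]
    · intro f
      have : Xf x * W ^ (n + 1) - W ^ (n + 1) * Xf x =
          (Xf x * W ^ n - W ^ n * Xf x) * W + W ^ n * (Xf x * W - W * Xf x) := by
        apply LinearMap.ext
        intro g
        simp only [pow_succ, LinearMap.sub_apply, LinearMap.add_apply, Module.End.mul_apply, map_sub]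
        abel
      rw [this, LinearMap.add_apply, map_add, Module.End.mul_apply, Module.End.mul_apply]
      refine (norm_add_le _ _).trans ?_
      have h1 := ih.2 (W f)
      have h2 := ih.1 ((Xf x * W - W * Xf x) f)
      have h3 := hV f
      rw [hW] at h1
      push_cast
      linarith

/-- Lemma `v ≤ t`: for every `t ∈ [0,1]`, every local field `D`,
every `N ∈ ℤ⁺`, and every unit vector `Ψ₀` supported on `span{δ₀, δ₁}`,
`(1/N)⟨X⟩_{U_{t,D}^N Ψ₀} ≤ (1/N)‖[X, U_{t,D}^N]‖ ≤ t`. -/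
theorem stmt0 (t : ℝ) (ht : t ∈ Set.Icc (0 : ℝ) 1)
    (B C D : Op) (hB : IsB B) (hC : IsC C) (hD : IsLocalField D)
    (x : ℤ → ℝ) (hx : IsPos x)
    (N : ℕ) (hN : 0 < N)
    (Ψ₀ : Hqw) (hΨ : IsInit Ψ₀)
    (K : Op) (hK : IsXComm x ((D * Ut t B C) ^ N) K) :
    (1 / (N : ℝ)) * Xexp x (((D * Ut t B C) ^ N) Ψ₀) ≤ (1 / (N : ℝ)) * ‖K‖ ∧
      (1 / (N : ℝ)) * ‖K‖ ≤ t := by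
  obtain ⟨θ, hθ⟩ := hD
  have hDf : ∀ f, D (iot f) = iot (Df θ f) := by
    intro f
    have : D.toLinearMap.comp iot = iot.comp (Df θ) := by
      apply hom_ext'
      intro j
      simp only [LinearMap.comp_apply, Df, ext_ee, map_smul, iot_ee]
      exact hθ j
    exact congrArg (fun L => L f) this
  set W := Df θ * Uf t with hWdef
  have hA1 : ∀ f, (D * Ut t B C) (iot f) = iot (W f) := by
    intro f
    rw [mul_apply_eq_comp, iot_Uf t B C hB hC, hDf]; rfl
  have hA : ∀ (n : ℕ) f, ((D * Ut t B C) ^ n) (iot f) = iot ((W ^ n) f) := by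
    intro n
    induction n with
    | zero => intro f; simp
    | succ n ih =>
      intro f
      rw [pow_succ, pow_succ, mul_apply_eq_comp, hA1, ih]; rfl
  have hW : ∀ f, ‖iot (W f)‖ = ‖iot f‖ := by
    intro f
    rw [hWdef, Module.End.mul_apply, norm_Df, norm_Uf t ht]
  have hV : ∀ f, ‖iot ((Xf x * W - W * Xf x) f)‖ ≤ t * ‖iot f‖ := by
    intro f
    have : Xf x * W - W * Xf x = Df θ * Vf x t := by
      rw [hWdef, ← mul_assoc, Xf_Df, Vf]
      apply LinearMap.ext
      intro g
      simp only [LinearMap.sub_apply, Module.End.mul_apply, map_sub]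
    rw [this, Module.End.mul_apply, norm_Df, norm_Vf x hx t ht]
  have hKf : ∀ f, K (iot f) = iot ((Xf x * W ^ N - W ^ N * Xf x) f) := by
    intro f
    have : K.toLinearMap.comp iot = iot.comp (Xf x * W ^ N - W ^ N * Xf x) := by
      apply hom_ext'
      intro j
      apply lp.ext
      funext i
      have h1 := hK i j
      rw [← iot_ee, hA, coord_iot] at h1
      change coord (K (iot (ee j))) i = coord (iot _) i
      rw [h1, coord_iot]
      simp only [LinearMap.sub_apply, Module.End.mul_apply, Xf_ee, map_smul, Finsupp.sub_apply,
        Xf_apply, Finsupp.smul_apply, smul_eq_mul]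
      push_cast; ring
    exact congrArg (fun L => L f) this
  have hb := comm_bound x W t hW hV N
  have hNpos : (0 : ℝ) < N := by exact_mod_cast hN
  constructor
  · refine mul_le_mul_of_nonneg_left ?_ (by positivity)
    obtain ⟨hn, a, b, hab⟩ := hΨ
    have hφ : Ψ₀ = iot (a • ee 0 + b • ee 1) := by
      rw [map_add, map_smul, map_smul, iot_ee, iot_ee, hab]
    generalize hφd : a • ee 0 + b • ee 1 = φ at hφ
    have hX0 : Xf x φ = 0 := by
      rw [← hφd, map_add, map_smul, map_smul, Xf_ee, Xf_ee]
      have h0 := (hx 0).1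
      have h1 := (hx 0).2
      simp at h0 h1
      simp [h0, h1]
    have hin : inner ℂ (iot ((W ^ N) φ)) (K Ψ₀) = ((Xexp x (((D * Ut t B C) ^ N) Ψ₀) : ℝ) : ℂ) := by
      rw [hφ, hA, hKf, lp.inner_eq_tsum, Xexp, Complex.ofReal_tsum]
      refine tsum_congr fun i => ?_
      change inner ℂ (coord (iot ((W ^ N) φ)) i)
        (coord (iot ((Xf x * W ^ N - W ^ N * Xf x) φ)) i) = _
      rw [coord_iot, coord_iot, LinearMap.sub_apply, Module.End.mul_apply, Module.End.mul_apply,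
        hX0, map_zero, sub_zero, Xf_apply]
      rw [RCLike.inner_apply, mul_assoc, Complex.mul_conj, Complex.normSq_eq_norm_sq]
      push_cast; rfl
    have hle := norm_inner_le_norm (𝕜 := ℂ) (iot ((W ^ N) φ)) (K Ψ₀)
    rw [hin, hb.1, ← hφ, hn, one_mul, Complex.norm_real] at hle
    refine (le_abs_self _).trans (hle.trans ?_)
    simpa [hn] using K.le_opNorm Ψ₀
  · have hKN : ‖K‖ ≤ N * t := by
      refine op_bound K _ (mul_nonneg hNpos.le ht.1) fun f => ?_
      rw [hKf]
      exact hb.2 f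
    rw [one_div, inv_mul_le_iff₀ hNpos]
    exact hKN
end
end

section
/- For every n ∈ ℤ⁺, every admissible α (an n-th root of unity α = e^{2πik/n} with gcd(k,n) = 1, α ≠ 1), and every t ∈ [0,1], the quantum walk U_{t,n} = D_n·U_t in the n-periodic field D_n satisfies limsup_{N→∞} (1/N)·‖[X, U_{t,n}^N]‖ ≤ (4t)^n; consequently the asymptotic velocity v = limsup_{N→∞} (1/N)·⟨X⟩_{U_{t,n}^N Ψ₀} satisfies v ≤ (4t)^n for every unit vector Ψ₀ supported on span{δ₀, δ₁}. -/
noncomputable section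

open Polynomial

theorem hasSum_delta (ψ : Hqw) : HasSum (fun j => coord ψ j • δ j) ψ := by
  have h := lp.hasSum_single (p := 2) (by norm_num) ψ
  convert h using 2 with j
  rw [δ, ← lp.single_smul, smul_eq_mul, mul_one, coord]

theorem coord_delta (i j : ℤ) : coord (δ j) i = if i = j then 1 else 0 := by
  unfold coord δ
  rw [lp.single_apply]
  split_ifs with h
  · subst h; simp
  · simp [h]

theorem coord_add (ψ φ : Hqw) (i : ℤ) : coord (ψ + φ) i = coord ψ i + coord φ i := rfl
theorem coord_sub (ψ φ : Hqw) (i : ℤ) : coord (ψ - φ) i = coord ψ i - coord φ i := rfl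
theorem coord_smul (c : ℂ) (ψ : Hqw) (i : ℤ) : coord (c • ψ) i = c * coord ψ i := rfl
theorem coord_zero (i : ℤ) : coord 0 i = 0 := rfl

theorem coord_eq_inner (ψ : Hqw) (i : ℤ) : coord ψ i = inner ℂ (δ i) ψ := by
  unfold δ coord
  rw [lp.inner_single_left]; simp

theorem coord_ext {ψ φ : Hqw} (h : ∀ i, coord ψ i = coord φ i) : ψ = φ := by
  ext i; exact h i

theorem op_ext {A A' : Op} (h : ∀ j, A (δ j) = A' (δ j)) : A = A' := by
  ext1 ψ
  have h1 := (hasSum_delta ψ).mapL A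
  have h2 := (hasSum_delta ψ).mapL A'
  simp only [map_smul, h] at h1 h2
  exact h1.unique h2

theorem hasSum_coord (A : Op) (ψ : Hqw) (i : ℤ) :
    HasSum (fun j => coord ψ j * coord (A (δ j)) i) (coord (A ψ) i) := by
  have h1 := ((hasSum_delta ψ).mapL A).mapL (innerSL ℂ (δ i))
  simp only [map_smul, innerSL_apply_apply, ← coord_eq_inner, smul_eq_mul] at h1
  exact h1

theorem exists_op (σ : ℤ → ℤ) (hσ : Function.Injective σ) (w : ℤ → ℂ) (hw : ∀ j, ‖w j‖ = 1) :
    ∃ A : Op, (∀ j, A (δ j) = w j • δ (σ j)) ∧ ∀ ψ, ‖A ψ‖ = ‖ψ‖ := by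
  have ho : Orthonormal ℂ (fun j => w j • δ (σ j)) := by
    rw [orthonormal_iff_ite]
    intro i j
    rw [inner_smul_left, inner_smul_right, ← coord_eq_inner, coord_delta]
    by_cases h : i = j
    · subst h
      have := Complex.conj_mul' (w i)
      simp [hw, this]
    · simp [h, hσ.ne h]
  refine ⟨ho.orthogonalFamily.linearIsometry.toContinuousLinearMap, ?_, ?_⟩
  · intro j
    simp [δ]
  · intro ψ
    simp

theorem opNorm_le_one {A : Op} (h : ∀ ψ, ‖A ψ‖ = ‖ψ‖) : ‖A‖ ≤ 1 :=
  ContinuousLinearMap.opNorm_le_bound _ zero_le_one fun ψ => by rw [h, one_mul]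

theorem op_mul_apply (A A' : Op) (ψ : Hqw) : (A * A') ψ = A (A' ψ) := rfl
theorem op_one_apply (ψ : Hqw) : (1 : Op) ψ = ψ := rfl

/-! commutators -/

theorem IsXComm.add {x : ℤ → ℝ} {A A' K K' : Op} (h : IsXComm x A K) (h' : IsXComm x A' K') :
    IsXComm x (A + A') (K + K') := by
  intro i j
  simp only [add_apply, coord_add, h i j, h' i j]
  ring

theorem IsXComm.smul {x : ℤ → ℝ} {A K : Op} (h : IsXComm x A K) (c : ℂ) :
    IsXComm x (c • A) (c • K) := by
  intro i j
  simp only [smul_apply, coord_smul, h i j]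
  ring

theorem IsXComm.zero {x : ℤ → ℝ} : IsXComm x 0 0 := by
  intro i j
  simp [coord_zero]

theorem IsXComm.diag {x : ℤ → ℝ} {A : Op} {σ : ℤ → ℤ} {w : ℤ → ℂ}
    (hA : ∀ j, A (δ j) = w j • δ (σ j)) (hx : ∀ j, x (σ j) = x j) : IsXComm x A 0 := by
  intro i j
  rw [hA, coord_smul, coord_delta]
  split_ifs with h
  · simp [h, hx, coord_zero]
  · simp [coord_zero]

theorem IsXComm.sum {x : ℤ → ℝ} {ι : Type*} (s : Finset ι) {A K : ι → Op}
    (h : ∀ i ∈ s, IsXComm x (A i) (K i)) : IsXComm x (∑ i ∈ s, A i) (∑ i ∈ s, K i) := by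
  classical
  induction s using Finset.induction_on with
  | empty => simpa using IsXComm.zero
  | insert a s ha ih =>
    rw [Finset.sum_insert ha, Finset.sum_insert ha]
    exact (h a (by simp)).add (ih fun i hi => h i (by simp [hi]))

theorem IsXComm.mul {x : ℤ → ℝ} {A A' K K' : Op} (h : IsXComm x A K) (h' : IsXComm x A' K') :
    IsXComm x (A * A') (K * A' + A * K') := by
  intro i j
  simp only [add_apply, coord_add]
  change coord (K (A' (δ j))) i + coord (A (K' (δ j))) i = _ * coord (A (A' (δ j))) i
  have h1 := hasSum_coord K (A' (δ j)) i
  have h2 := hasSum_coord A (K' (δ j)) i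
  have h3 := (hasSum_coord A (A' (δ j)) i).mul_left ((x i - x j : ℝ) : ℂ)
  refine (h1.add h2).unique ?_
  have e : (fun k => coord (A' (δ j)) k * coord (K (δ k)) i + coord (K' (δ j)) k * coord (A (δ k)) i)
      = fun k => ((x i - x j : ℝ) : ℂ) * (coord (A' (δ j)) k * coord (A (δ k)) i) := by
    funext k
    rw [h i k, h' k j]
    push_cast
    ring
  rw [e]
  exact h3

theorem IsXComm.unique {x : ℤ → ℝ} {A K K' : Op} (h : IsXComm x A K) (h' : IsXComm x A K') :
    K = K' := by
  refine op_ext fun j => coord_ext fun i => ?_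
  rw [h i j, h' i j]

/-! band operators -/

def Band (m : ℕ) (A : Op) : Prop := ∀ i j : ℤ, (m : ℤ) < |i - j| → coord (A (δ j)) i = 0

theorem Band.mul {m m' : ℕ} {A A' : Op} (h : Band m A) (h' : Band m' A') :
    Band (m + m') (A * A') := by
  intro i j hij
  have h1 := hasSum_coord A (A' (δ j)) i
  refine h1.unique ?_
  convert hasSum_zero with k
  by_cases hk : (m : ℤ) < |i - k|
  · rw [h _ _ hk, mul_zero]
  · rw [h' k j, zero_mul]
    have := abs_sub_le i k j
    push_cast at hij
    linarith

theorem Band.sum {m : ℕ} {ι : Type*} (s : Finset ι) {A : ι → Op}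
    (h : ∀ i ∈ s, Band m (A i)) : Band m (∑ i ∈ s, A i) := by
  classical
  induction s using Finset.induction_on with
  | empty => intro i j _; simp [coord_zero]
  | insert a s ha ih =>
    rw [Finset.sum_insert ha]
    intro i j hij
    rw [add_apply, coord_add, h a (by simp) i j hij,
      ih (fun i hi => h i (by simp [hi])) i j hij, add_zero]

theorem Band.perm {m : ℕ} {A : Op} {σ : ℤ → ℤ} {w : ℤ → ℂ}
    (hA : ∀ j, A (δ j) = w j • δ (σ j)) (hx : ∀ j, |σ j - j| ≤ m) : Band m A := by
  intro i j hij
  rw [hA, coord_smul, coord_delta, if_neg, mul_zero]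
  rintro rfl
  exact absurd (hx j) (not_le.mpr hij)

theorem Band.smul {m : ℕ} {A : Op} (h : Band m A) (c : ℂ) : Band m (c • A) := by
  intro i j hij
  rw [smul_apply, coord_smul, h i j hij, mul_zero]

theorem Band.zero {m : ℕ} : Band m 0 := by intro i j _; simp [coord_zero]

def PBand (P : Op[X]) : Prop := ∀ k, Band k (P.coeff k)

theorem PBand.mul {P Q : Op[X]} (hP : PBand P) (hQ : PBand Q) : PBand (P * Q) := by
  intro k
  rw [coeff_mul]
  refine Band.sum _ fun p hp => ?_
  rw [← Finset.HasAntidiagonal.mem_antidiagonal.mp hp]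
  exact (hP _).mul (hQ _)

theorem band_one (k : ℕ) : Band k (1 : Op) :=
  Band.perm (σ := id) (w := 1) (by simp) (by simp)

theorem PBand.pow {P : Op[X]} (hP : PBand P) (n : ℕ) : PBand (P ^ n) := by
  induction n with
  | zero =>
    intro k
    rw [pow_zero, coeff_one]
    split_ifs
    · exact band_one k
    · exact Band.zero
  | succ n ih => rw [pow_succ]; exact ih.mul hP

/-! majorants -/

def Maj (x : ℤ → ℝ) (t : ℝ) (P : Op[X]) (p q : ℝ[X]) : Prop :=
  ∀ k, ‖P.coeff k‖ ≤ t ^ k * p.coeff k ∧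
    ∃ K, IsXComm x (P.coeff k) K ∧ ‖K‖ ≤ t ^ k * q.coeff k

theorem Maj.mul {x : ℤ → ℝ} {t : ℝ} {P Q : Op[X]} {p q p' q' : ℝ[X]}
    (h : Maj x t P p q) (h' : Maj x t Q p' q') : Maj x t (P * Q) (p * p') (q * p' + p * q') := by
  intro k
  have key : ∀ a b : ℝ[X], t ^ k * (a * b).coeff k =
      ∑ ij ∈ Finset.HasAntidiagonal.antidiagonal k, (t ^ ij.1 * a.coeff ij.1) * (t ^ ij.2 * b.coeff ij.2) := by
    intro a b
    rw [coeff_mul, Finset.mul_sum]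
    refine Finset.sum_congr rfl fun ij hij => ?_
    rw [← Finset.HasAntidiagonal.mem_antidiagonal.mp hij]
    ring
  constructor
  · rw [key, coeff_mul]
    refine norm_sum_le_of_le _ fun ij _ => ?_
    refine (norm_mul_le _ _).trans ?_
    exact mul_le_mul (h _).1 (h' _).1 (norm_nonneg _) ((norm_nonneg _).trans (h _).1)
  · choose hn K hK using h
    choose hn' K' hK' using h'
    refine ⟨∑ ij ∈ Finset.HasAntidiagonal.antidiagonal k, (K ij.1 * Q.coeff ij.2 + P.coeff ij.1 * K' ij.2), ?_, ?_⟩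
    · rw [coeff_mul]
      exact IsXComm.sum _ fun ij _ => (hK _).1.mul (hK' _).1
    · rw [coeff_add, mul_add, key, key, ← Finset.sum_add_distrib]
      refine norm_sum_le_of_le _ fun ij _ => ?_
      refine (norm_add_le _ _).trans (add_le_add ?_ ?_)
      · refine (norm_mul_le _ _).trans ?_
        exact mul_le_mul (hK _).2 (hn' _) (norm_nonneg _) ((norm_nonneg _).trans (hK _).2)
      · refine (norm_mul_le _ _).trans ?_
        exact mul_le_mul (hn _) (hK' _).2 (norm_nonneg _) ((norm_nonneg _).trans (hn _))

theorem Maj.one {x : ℤ → ℝ} {t : ℝ} : Maj x t 1 1 0 := by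
  intro k
  rw [coeff_one, coeff_one]
  split_ifs with h
  · subst h
    have h1 : ‖(1 : Op)‖ ≤ 1 := ContinuousLinearMap.norm_id_le
    refine ⟨by simpa using h1, 0, ?_, by simp⟩
    exact IsXComm.diag (σ := id) (w := 1) (by simp) (by simp)
  · exact ⟨by simp, 0, IsXComm.zero, by simp⟩

theorem Maj.pow {x : ℤ → ℝ} {t : ℝ} {P : Op[X]} {p q : ℝ[X]}
    (h : Maj x t P p q) (n : ℕ) : Maj x t (P ^ n) (p ^ n) (n * p ^ (n - 1) * q) := by
  induction n with
  | zero => simpa using Maj.one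
  | succ n ih =>
    have := ih.mul h
    rw [← pow_succ, ← pow_succ] at this
    convert this using 1
    rcases n with _ | n
    · simp
    · simp only [Nat.add_sub_cancel]
      push_cast
      ring

/-- `r + t s A` -/
def lin (r t : ℝ) (A : Op) : Op[X] := monomial 0 ((r : ℂ) • (1 : Op)) + monomial 1 ((t : ℂ) • A)

theorem lin_coeff_zero (r t : ℝ) (A : Op) : (lin r t A).coeff 0 = (r : ℂ) • (1 : Op) := by
  simp [lin]
theorem lin_coeff_one (r t : ℝ) (A : Op) : (lin r t A).coeff 1 = (t : ℂ) • A := by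
  simp [lin, coeff_monomial]
theorem lin_coeff_ge (r t : ℝ) (A : Op) (k : ℕ) : (lin r t A).coeff (k + 2) = 0 := by
  simp [lin, coeff_monomial]

theorem lin_PBand {r t : ℝ} {A : Op} (h : Band 1 A) : PBand (lin r t A) := by
  intro k
  rcases k with _ | _ | k
  · rw [lin_coeff_zero]; exact (band_one 0).smul _
  · rw [zero_add, lin_coeff_one]; exact h.smul _
  · rw [lin_coeff_ge]; exact Band.zero

theorem lin_Maj {x : ℤ → ℝ} {r t b : ℝ} {A K : Op} (hr : 0 ≤ r) (hr1 : r ≤ 1) (ht : 0 ≤ t)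
    (hA : ‖A‖ ≤ 1) (hK : IsXComm x A K) (hKb : ‖K‖ ≤ b) :
    Maj x t (lin r t A) (1 + X) (C b * X) := by
  intro k
  rcases k with _ | _ | k
  · rw [lin_coeff_zero]
    refine ⟨?_, 0, ?_, ?_⟩
    · rw [norm_smul]
      have : ‖(1 : Op)‖ ≤ 1 := ContinuousLinearMap.norm_id_le
      simp only [Complex.norm_real, Real.norm_eq_abs, abs_of_nonneg hr]
      simp
      nlinarith [norm_nonneg (1 : Op)]
    · exact IsXComm.diag (σ := id) (w := fun _ => (r : ℂ)) (fun j => rfl) (by simp)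
    · simp
  · rw [zero_add, lin_coeff_one]
    refine ⟨?_, _, hK.smul _, ?_⟩
    · rw [norm_smul]
      simp [abs_of_nonneg ht, coeff_one]
      exact mul_le_of_le_one_right ht hA
    · rw [norm_smul]
      simp [abs_of_nonneg ht]
      gcongr
  · rw [lin_coeff_ge]
    refine ⟨?_, 0, IsXComm.zero, ?_⟩
    · simp [coeff_one, coeff_X]
    · simp [coeff_X]

/-! the scalar structure of the low order coefficients -/

def s1 (j : ℤ) : ℤ := if Even j then j - 1 else j + 1
def s2 (j : ℤ) : ℤ := if Even j then j + 1 else j - 1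
def w1 (j : ℤ) : ℂ := if Even j then 1 else -1
def w2 (j : ℤ) : ℂ := if Even j then -1 else 1

theorem s1_even {j : ℤ} (h : Even j) : s1 j = j - 1 := if_pos h
theorem s1_odd {j : ℤ} (h : ¬ Even j) : s1 j = j + 1 := if_neg h
theorem s2_even {j : ℤ} (h : Even j) : s2 j = j + 1 := if_pos h
theorem s2_odd {j : ℤ} (h : ¬ Even j) : s2 j = j - 1 := if_neg h
theorem w1_even {j : ℤ} (h : Even j) : w1 j = 1 := if_pos h
theorem w1_odd {j : ℤ} (h : ¬ Even j) : w1 j = -1 := if_neg h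
theorem w2_even {j : ℤ} (h : Even j) : w2 j = -1 := if_pos h
theorem w2_odd {j : ℤ} (h : ¬ Even j) : w2 j = 1 := if_neg h

theorem s1_s1 (j : ℤ) : s1 (s1 j) = j := by
  by_cases h : Even j
  · rw [s1_even h, s1_odd (by grind)]; ring
  · rw [s1_odd h, s1_even (by grind)]; ring

theorem s2_s2 (j : ℤ) : s2 (s2 j) = j := by
  by_cases h : Even j
  · rw [s2_even h, s2_odd (by grind)]; ring
  · rw [s2_odd h, s2_even (by grind)]; ring

theorem sq_neg_one1 {A : Op} (hA : ∀ j, A (δ j) = w1 j • δ (s1 j)) : A * A = -1 := by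
  refine op_ext fun j => ?_
  change A (A (δ j)) = - δ j
  rw [hA, map_smul, hA, s1_s1, smul_smul]
  by_cases h : Even j
  · rw [s1_even h, w1_even h, w1_odd (by grind)]; simp
  · rw [s1_odd h, w1_odd h, w1_even (by grind)]; simp

theorem sq_neg_one2 {A : Op} (hA : ∀ j, A (δ j) = w2 j • δ (s2 j)) : A * A = -1 := by
  refine op_ext fun j => ?_
  change A (A (δ j)) = - δ j
  rw [hA, map_smul, hA, s2_s2, smul_smul]
  by_cases h : Even j
  · rw [s2_even h, w2_even h, w2_odd (by grind)]; simp
  · rw [s2_odd h, w2_odd h, w2_even (by grind)]; simp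

theorem refl1 {A1 A2 E : Op} (hA1 : ∀ j, A1 (δ j) = w1 j • δ (s1 j))
    (hA2 : ∀ j, A2 (δ j) = w2 j • δ (s2 j)) (m : ℤ) (hE : ∀ j, E (δ j) = δ (2 * m - j)) :
    E * A1 = (-A2) * E := by
  refine op_ext fun j => ?_
  change E (A1 (δ j)) = - A2 (E (δ j))
  rw [hA1, map_smul, hE, hE, hA2]
  by_cases h : Even j
  · have h' : Even (2 * m - j) := by grind
    rw [s1_even h, w1_even h, w2_even h', s2_even h']; simp; congr 1; ring
  · have h' : ¬ Even (2 * m - j) := by grind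
    rw [s1_odd h, w1_odd h, w2_odd h', s2_odd h']; simp; congr 1; ring

theorem refl2 {A1 A2 E : Op} (hA1 : ∀ j, A1 (δ j) = w1 j • δ (s1 j))
    (hA2 : ∀ j, A2 (δ j) = w2 j • δ (s2 j)) (m : ℤ) (hE : ∀ j, E (δ j) = δ (2 * m - j)) :
    E * A2 = (-A1) * E := by
  refine op_ext fun j => ?_
  change E (A2 (δ j)) = - A1 (E (δ j))
  rw [hA2, map_smul, hE, hE, hA1]
  by_cases h : Even j
  · have h' : Even (2 * m - j) := by grind
    rw [s2_even h, w2_even h, w1_even h', s1_even h']; simp; congr 1; ring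
  · have h' : ¬ Even (2 * m - j) := by grind
    rw [s2_odd h, w2_odd h, w1_odd h', s1_odd h']; simp; congr 1; ring

theorem mono_lin {r t : ℝ} {E A A' : Op} (h : E * A = A' * E) :
    monomial 0 E * lin r t A = lin r t A' * monomial 0 E := by
  simp only [lin, mul_add, add_mul, monomial_mul_monomial, mul_smul_comm, smul_mul_assoc, h,
    mul_one, one_mul, add_zero, zero_add]

def rho (r t : ℝ) : ℂ[X] := monomial 0 ((r : ℂ) ^ 2) + monomial 2 ((t : ℂ) ^ 2)

def emb : ℂ[X] →+* Op[X] := mapRingHom (algebraMap ℂ Op)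

theorem emb_coeff (p : ℂ[X]) (k : ℕ) : (emb p).coeff k = p.coeff k • (1 : Op) := by
  simp [emb, Algebra.algebraMap_eq_smul_one]

theorem emb_comm (p : ℂ[X]) (Q : Op[X]) : Q * emb p = emb p * Q := by
  ext1 k
  rw [coeff_mul, coeff_mul, ← Finset.Nat.sum_antidiagonal_swap]
  refine Finset.sum_congr rfl fun ij _ => ?_
  simp [emb_coeff]

theorem lin_mul_lin {r t : ℝ} {A : Op} (h : A * A = -1) :
    lin r t A * lin r t (-A) = emb (rho r t) := by
  simp only [lin, mul_add, add_mul, monomial_mul_monomial]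
  simp only [rho, emb, map_add, coe_mapRingHom,
    map_monomial, Algebra.algebraMap_eq_smul_one, mul_smul_comm, smul_mul_assoc, h,
    mul_one, one_mul, add_zero, zero_add, smul_smul, pow_two, mul_neg, smul_neg, neg_neg, map_neg]
  rw [mul_comm (r : ℂ) (t : ℂ)]
  abel

theorem ring_aux {S : Type*} [Ring S] {d e f L M L' M' ρ : S} (hFD' : f * d = e)
    (e1 : e * L = M' * e) (e2 : e * M = L' * e) (l1 : L * L' = ρ) (l2 : M * M' = ρ)
    (c1 : ∀ q, q * ρ = ρ * q) :
    d * (L * M) * f * (d * (L * M)) = ρ * ρ * (d * e) := by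
  calc d * (L * M) * f * (d * (L * M)) = d * L * M * (f * d) * L * M := by simp only [mul_assoc]
    _ = d * L * M * (e * L) * M := by rw [hFD']; simp only [mul_assoc]
    _ = d * L * (M * M') * (e * M) := by rw [e1]; simp only [mul_assoc]
    _ = d * (L * ρ) * (L' * e) := by rw [l2, e2]; simp only [mul_assoc]
    _ = (d * ρ) * (L * L') * e := by rw [c1 L]; simp only [mul_assoc]
    _ = ρ * ρ * (d * e) := by rw [l1, c1 d, mul_assoc ρ d ρ, c1 d]; simp only [mul_assoc]

theorem Y_refl {r t : ℝ} {α : ℂ} (hα0 : α ≠ 0) {A1 A2 D E F : Op}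
    (hA1 : ∀ j, A1 (δ j) = w1 j • δ (s1 j))
    (hA2 : ∀ j, A2 (δ j) = w2 j • δ (s2 j)) (hD : IsDn α D) (m : ℤ)
    (hE : ∀ j, E (δ j) = δ (2 * m - j)) (hF : ∀ j, F (δ j) = α ^ (-j) • δ (2 * m - j)) :
    (monomial 0 D * (lin r t A1 * lin r t A2)) * monomial 0 F *
      (monomial 0 D * (lin r t A1 * lin r t A2)) =
    emb (monomial 0 (α ^ (2 * m)) * rho r t ^ 2) * monomial 0 F := by
  have hFD : F * D = E := by
    refine op_ext fun j => ?_
    change F (D (δ j)) = E (δ j)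
    rw [hD, map_smul, hF, hE, smul_smul, ← zpow_add₀ hα0]
    simp
  have hDE : D * E = α ^ (2 * m) • F := by
    refine op_ext fun j => ?_
    change D (E (δ j)) = α ^ (2 * m) • F (δ j)
    rw [hE, hD, hF, smul_smul, ← zpow_add₀ hα0, sub_eq_add_neg]
  have hFD' : (monomial 0 F : Op[X]) * monomial 0 D = monomial 0 E := by
    rw [monomial_mul_monomial, hFD]
  have hDE' : (monomial 0 D : Op[X]) * monomial 0 E = emb (monomial 0 (α ^ (2 * m))) * monomial 0 F := by
    rw [monomial_mul_monomial, hDE, emb, coe_mapRingHom, map_monomial, monomial_mul_monomial,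
      Algebra.algebraMap_eq_smul_one, smul_mul_assoc, one_mul]
  have e1 := mono_lin (r := r) (t := t) (refl1 hA1 hA2 m hE)
  have e2 := mono_lin (r := r) (t := t) (refl2 hA1 hA2 m hE)
  have l1 := lin_mul_lin (r := r) (t := t) (sq_neg_one1 hA1)
  have l2 := lin_mul_lin (r := r) (t := t) (sq_neg_one2 hA2)
  rw [map_mul, map_pow]
  have := ring_aux hFD' e1 e2 l1 l2 (emb_comm (rho r t))
  rw [this, hDE', ← mul_assoc, emb_comm, pow_two]

theorem pow_refl {Y f : Op[X]} {R : ℂ[X]} (h : Y * f * Y = emb R * f) (n : ℕ) :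
    Y ^ n * f * Y ^ n = emb (R ^ n) * f := by
  induction n with
  | zero => simp
  | succ n ih =>
    calc Y ^ (n + 1) * f * Y ^ (n + 1) = Y ^ n * (Y * f * Y) * Y ^ n := by
          rw [pow_succ]; nth_rewrite 2 [← pow_succ]; rw [pow_succ']; simp only [mul_assoc]
      _ = emb R * (Y ^ n * f * Y ^ n) := by
          rw [h, ← mul_assoc, emb_comm]; simp only [mul_assoc]
      _ = _ := by rw [ih, ← mul_assoc, ← map_mul, pow_succ']

theorem scalar_coeff {n : ℕ} {α : ℂ} (hα : IsPrimitiveRoot α n) (hα1 : ‖α‖ = 1)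
    {r t : ℝ} (hr : r ≠ 0) {A1 A2 D : Op}
    (hA1 : ∀ j, A1 (δ j) = w1 j • δ (s1 j))
    (hA2 : ∀ j, A2 (δ j) = w2 j • δ (s2 j)) (hD : IsDn α D)
    (hb : PBand ((monomial 0 D * (lin r t A1 * lin r t A2)) ^ n)) (k : ℕ) (hk : k < n) :
    ∃ c : ℂ, ((monomial 0 D * (lin r t A1 * lin r t A2)) ^ n).coeff k = c • (1 : Op) := by
  have hα0 : α ≠ 0 := by rintro rfl; simp at hα1
  have hDn : D ^ n = 1 := by
    have : ∀ m : ℕ, ∀ j, (D ^ m) (δ j) = (α ^ j) ^ m • δ j := by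
      intro m
      induction m with
      | zero => intro j; simp
      | succ m ih =>
        intro j
        rw [pow_succ]
        change (D ^ m) (D (δ j)) = _
        rw [hD, map_smul, ih, smul_smul, pow_succ']
    refine op_ext fun j => ?_
    rw [this, ← zpow_natCast, ← zpow_mul, mul_comm, zpow_mul, zpow_natCast, hα.pow_eq_one]
    simp
  set Y := monomial 0 D * (lin r t A1 * lin r t A2) with hY
  set P := Y ^ n with hP
  have hY0 : Y.coeff 0 = ((r : ℂ) ^ 2) • D := by
    rw [hY, mul_coeff_zero, mul_coeff_zero, lin_coeff_zero, lin_coeff_zero]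
    rw [coeff_monomial, if_pos rfl, smul_mul_assoc, one_mul, smul_smul, mul_smul_comm, mul_one, pow_two]
  have hP0 : P.coeff 0 = ((r : ℂ) ^ 2) ^ n • (1 : Op) := by
    have : ∀ m : ℕ, (Y ^ m).coeff 0 = (Y.coeff 0) ^ m := by
      intro m
      induction m with
      | zero => simp
      | succ m ih => rw [pow_succ, mul_coeff_zero, ih, pow_succ]
    rw [hP, this, hY0, _root_.smul_pow, hDn]
  have hrc : (r : ℂ) ≠ 0 := by exact_mod_cast hr
  have hcomm : P * Y = Y * P := by rw [hP, ← pow_succ, ← pow_succ']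
  induction k using Nat.strong_induction_on with
  | _ k ih =>
  rcases Nat.eq_zero_or_pos k with rfl | hkpos
  · exact ⟨_, hP0⟩
  choose! c hc using fun j (hj : j < k) => ih j hj (hj.trans hk)
  -- `P_k` commutes with `D`
  have hPD : P.coeff k * D = D * P.coeff k := by
    have h1 := congrArg (fun Q => Q.coeff k) hcomm
    simp only [coeff_mul] at h1
    rw [← Finset.Nat.sum_antidiagonal_swap (n := k) (f := fun x => Y.coeff x.1 * P.coeff x.2)] at h1
    rw [← sub_eq_zero, ← Finset.sum_sub_distrib,
      Finset.sum_eq_single_of_mem (k, 0) (by simp)] at h1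
    · simp only [hY0, Prod.swap_prod_mk] at h1
      rw [mul_smul_comm, smul_mul_assoc, ← smul_sub, smul_eq_zero] at h1
      rcases h1 with h1 | h1
      · exact absurd h1 (pow_ne_zero 2 hrc)
      · exact sub_eq_zero.mp h1
    · rintro ⟨i, j⟩ hij hne
      have hij' : i + j = k := by simpa using hij
      have hi : i < k := by
        rcases Nat.eq_zero_or_pos j with rfl | hj
        · exact absurd (by simp at hij'; simp [hij']) hne
        · omega
      simp [hc i hi]
  -- `P_k` is diagonal
  have hdiag : ∀ j, P.coeff k (δ j) = coord (P.coeff k (δ j)) j • δ j := by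
    intro j
    refine coord_ext fun i => ?_
    rw [coord_smul, coord_delta]
    split_ifs with h
    · rw [h, mul_one]
    rw [mul_zero]
    by_cases hlt : (k : ℤ) < |i - j|
    · exact hb k i j hlt
    have h2 : coord ((P.coeff k * D) (δ j)) i = α ^ j * coord (P.coeff k (δ j)) i := by
      change coord (P.coeff k (D (δ j))) i = _
      rw [hD, map_smul, coord_smul]
    have h3 : coord ((D * P.coeff k) (δ j)) i = α ^ i * coord (P.coeff k (δ j)) i := by
      change coord (D (P.coeff k (δ j))) i = _
      refine (hasSum_coord D _ i).unique ?_
      have := hasSum_ite_eq i (α ^ i * coord (P.coeff k (δ j)) i)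
      convert this using 1
      funext l
      rw [hD, coord_smul, coord_delta]
      by_cases hl : l = i
      · subst hl; simp [mul_comm]
      · simp [hl, Ne.symm hl]
    rw [hPD, h3] at h2
    by_contra hne
    have h4 : α ^ i = α ^ j := mul_right_cancel₀ hne h2
    have h5 : α ^ (i - j) = 1 := by
      rw [zpow_sub₀ hα0, h4, div_self (zpow_ne_zero _ hα0)]
    have h6 := (hα.zpow_eq_one_iff_dvd _).mp h5
    have h7 := Int.eq_zero_of_abs_lt_dvd h6 (by push Not at hlt; exact hlt.trans_lt (by exact_mod_cast hk))
    exact h (by linarith)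
  -- reflection
  refine ⟨(((rho r t ^ 2) ^ n).coeff k - ∑ ij ∈ (Finset.HasAntidiagonal.antidiagonal k \ {(0, k), (k, 0)}),
      c ij.1 * c ij.2) / (2 * ((r : ℂ) ^ 2) ^ n), ?_⟩
  refine op_ext fun m => ?_
  rw [hdiag m]
  set p := coord (P.coeff k (δ m)) m with hp
  obtain ⟨E, hE, -⟩ := exists_op (fun j => 2 * m - j) (fun a b h => by simpa using h) (fun _ => 1) (by simp)
  obtain ⟨F, hF, -⟩ := exists_op (fun j => 2 * m - j) (fun a b h => by simpa using h)
    (fun j => α ^ (-j)) (by simp [hα1])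
  simp only [one_smul] at hE
  have hrefl := pow_refl (Y_refl (r := r) (t := t) hα0 hA1 hA2 hD m hE hF) n
  have hR : (monomial 0 (α ^ (2 * m)) * rho r t ^ 2) ^ n = (rho r t ^ 2) ^ n := by
    rw [mul_pow, monomial_pow, ← zpow_natCast, ← zpow_mul, mul_comm (2 * m), zpow_mul, zpow_natCast,
      hα.pow_eq_one]
    simp
  rw [hR, ← hY, ← hP] at hrefl
  have h1 := congrArg (fun Q => Q.coeff k) hrefl
  simp only [monomial_zero_left, coeff_mul_C, emb_coeff] at h1
  rw [coeff_mul] at h1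
  simp only [coeff_mul_C] at h1
  have hsub : ({(0, k), (k, 0)} : Finset (ℕ × ℕ)) ⊆ Finset.HasAntidiagonal.antidiagonal k := by
    intro y hy
    simp at hy
    rcases hy with rfl | rfl <;> simp
  rw [← Finset.sum_sdiff hsub, Finset.sum_pair (by simp; omega), hP0] at h1
  have hsum : ∑ ij ∈ (Finset.HasAntidiagonal.antidiagonal k \ {(0, k), (k, 0)}),
      P.coeff ij.1 * F * P.coeff ij.2 =
      (∑ ij ∈ (Finset.HasAntidiagonal.antidiagonal k \ {(0, k), (k, 0)}), c ij.1 * c ij.2) • F := by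
    rw [Finset.sum_smul]
    refine Finset.sum_congr rfl fun ij hij => ?_
    obtain ⟨i, j⟩ := ij
    simp at hij
    rw [hc i (by omega), hc j (by omega)]
    simp [smul_smul, mul_comm]
  rw [hsum] at h1
  have h2 := congrArg (fun Q : Op => Q (δ m)) h1
  have hFm : F (δ m) = α ^ (-m) • δ m := by rw [hF]; congr 2; ring
  have h3 : P.coeff k (δ m) = p • δ m := hdiag m
  simp only [add_apply, smul_apply, op_mul_apply, smul_mul_assoc, one_mul,
    mul_smul_comm, mul_one, hFm, h3, map_smul, smul_smul, ← add_smul] at h2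
  have h4 := congrArg (fun ψ => coord ψ m) h2
  simp only [coord_smul, coord_delta, if_true, mul_one] at h4
  rw [smul_apply, op_one_apply]
  congr 1
  have ha : α ^ (-m) ≠ 0 := zpow_ne_zero _ hα0
  have hrn : ((r : ℂ) ^ 2) ^ n ≠ 0 := pow_ne_zero _ (pow_ne_zero _ hrc)
  rw [eq_div_iff (by simp [hrc]), eq_sub_iff_add_eq]
  apply mul_right_cancel₀ ha
  linear_combination h4

/-! evaluation and the final bounds -/

def NN (p : ℝ[X]) : Prop := ∀ k, 0 ≤ p.coeff k

theorem NN.mul {p q : ℝ[X]} (hp : NN p) (hq : NN q) : NN (p * q) := by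
  intro k
  rw [coeff_mul]
  exact Finset.sum_nonneg fun ij _ => mul_nonneg (hp _) (hq _)

theorem NN.add {p q : ℝ[X]} (hp : NN p) (hq : NN q) : NN (p + q) := by
  intro k
  rw [coeff_add]
  exact add_nonneg (hp _) (hq _)

theorem NN.one : NN 1 := by
  intro k
  rw [coeff_one]; split_ifs <;> simp

theorem NN.X : NN Polynomial.X := by
  intro k
  rw [coeff_X]; split_ifs <;> simp

theorem NN.C {b : ℝ} (hb : 0 ≤ b) : NN (C b) := by
  intro k
  rw [coeff_C]; split_ifs <;> simp [hb]

theorem NN.pow {p : ℝ[X]} (hp : NN p) (n : ℕ) : NN (p ^ n) := by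
  induction n with
  | zero => simpa using NN.one
  | succ n ih => rw [pow_succ]; exact ih.mul hp

def ev : Op[X] →+* Op := eval₂RingHom' (RingHom.id Op) 1 (fun _ => Commute.one_right _)

theorem ev_sum (P : Op[X]) (N : ℕ) (hN : P.natDegree < N) :
    ev P = ∑ k ∈ Finset.range N, P.coeff k := by
  have := eval₂_eq_sum_range' (RingHom.id Op) hN 1
  simpa [ev, eval₂RingHom'] using this

theorem ev_monomial (k : ℕ) (A : Op) : ev (monomial k A) = A := by
  simp [ev, eval₂RingHom']

theorem ev_lin (r t : ℝ) (A : Op) : ev (lin r t A) = (r : ℂ) • (1 : Op) + (t : ℂ) • A := by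
  rw [lin, map_add, ev_monomial, ev_monomial]

theorem comm_bound_s4 {x : ℤ → ℝ} {t : ℝ} {P : Op[X]} {p q : ℝ[X]} (h : Maj x t P p q) (hq : NN q)
    (ht : 0 ≤ t) (ht1 : t ≤ 1) (n : ℕ) (hs : ∀ k < n, IsXComm x (P.coeff k) 0)
    {K : Op} (hK : IsXComm x (ev P) K) : ‖K‖ ≤ t ^ n * q.eval 1 := by
  have h1 : ∀ k, ∃ K, IsXComm x (P.coeff k) K ∧ ‖K‖ ≤ t ^ n * q.coeff k := by
    intro k
    by_cases hk : k < n
    · refine ⟨0, hs k hk, ?_⟩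
      · rw [norm_zero]; exact mul_nonneg (pow_nonneg ht _) (hq k)
    · obtain ⟨-, K, hK, hKb⟩ := h k
      refine ⟨K, hK, hKb.trans ?_⟩
      exact mul_le_mul_of_nonneg_right (pow_le_pow_of_le_one ht ht1 (by omega)) (hq k)
  choose L hL hLb using h1
  set N := max P.natDegree q.natDegree + 1
  have h2 : IsXComm x (ev P) (∑ k ∈ Finset.range N, L k) := by
    rw [ev_sum P N (by omega)]
    exact IsXComm.sum _ fun k _ => hL k
  rw [hK.unique h2, eval_eq_sum_range' (n := N) (by omega), Finset.mul_sum]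
  refine norm_sum_le_of_le _ fun k _ => ?_
  simpa using hLb k

theorem lin_isom {r t : ℝ} (hrt : r ^ 2 + t ^ 2 = 1) {A : Op} (hA : ∀ ψ, ‖A ψ‖ = ‖ψ‖)
    (hA2 : A * A = -1) (ψ : Hqw) : ‖((r : ℂ) • (1 : Op) + (t : ℂ) • A) ψ‖ = ‖ψ‖ := by
  have hAA : A (A ψ) = -ψ := by
    rw [← op_mul_apply, hA2]; rfl
  have hre : RCLike.re (inner ℂ ψ (A ψ)) = (0 : ℝ) := by
    have hi : inner ℂ (A ψ) (A (A ψ)) = inner ℂ ψ (A ψ) := by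
      let T : Hqw →ₗᵢ[ℂ] Hqw := ⟨A.toLinearMap, hA⟩
      exact T.inner_map_map ψ (A ψ)
    rw [hAA, inner_neg_right] at hi
    have h2 := inner_re_symm (𝕜 := ℂ) ψ (A ψ)
    have h3 := congrArg RCLike.re hi
    rw [map_neg] at h3
    linarith
  have hsq : ‖((r : ℂ) • (1 : Op) + (t : ℂ) • A) ψ‖ ^ 2 = ‖ψ‖ ^ 2 := by
    rw [add_apply, smul_apply, smul_apply, op_one_apply, norm_add_sq (𝕜 := ℂ), inner_smul_left,
      inner_smul_right, norm_smul, norm_smul, hA]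
    have : RCLike.re ((starRingEnd ℂ) (r : ℂ) * ((t : ℂ) * inner ℂ ψ (A ψ))) = (0 : ℝ) := by
      rw [Complex.conj_ofReal]
      simp at hre
      simp [hre]
    rw [this, mul_pow, mul_pow]
    simp
    linear_combination ‖ψ‖ ^ 2 * hrt
  exact (pow_left_inj₀ (norm_nonneg _) (norm_nonneg _) two_ne_zero).mp hsq

theorem exists_A1 {x : ℤ → ℝ} (hx : IsPos x) : ∃ A K : Op, (∀ j, A (δ j) = w1 j • δ (s1 j)) ∧
    (∀ ψ, ‖A ψ‖ = ‖ψ‖) ∧ IsXComm x A K ∧ ‖K‖ ≤ 1 := by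
  have hinj : Function.Injective s1 := Function.LeftInverse.injective s1_s1
  have hw : ∀ j, ‖w1 j‖ = 1 := by intro j; unfold w1; split_ifs <;> simp
  have habs : ∀ a : ℤ, |(|((a - 1 : ℤ) : ℝ)| - |(a : ℝ)|)| = 1 := by
    intro a
    rw [← Int.cast_abs, ← Int.cast_abs, ← Int.cast_sub, ← Int.cast_abs]
    have : |(|a - 1| - |a|)| = 1 := by grind
    rw [this]; simp
  have hxs : ∀ j, |x (s1 j) - x j| = 1 := by
    intro j
    by_cases h : Even j
    · obtain ⟨a, rfl⟩ := h.two_dvd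
      rw [s1_even h, (hx a).1, show 2 * a - 1 = 2 * (a - 1) + 1 by ring, (hx _).2]
      exact habs a
    · obtain ⟨a, rfl⟩ := Int.not_even_iff_odd.mp h
      rw [s1_odd h, (hx a).2, show 2 * a + 1 + 1 = 2 * (a + 1) by ring, (hx _).1, abs_sub_comm]
      have := habs (a + 1)
      rwa [add_sub_cancel_right] at this
  obtain ⟨A, hA, hAn⟩ := exists_op s1 hinj w1 hw
  obtain ⟨K, hK, hKn⟩ := exists_op s1 hinj (fun j => ((x (s1 j) - x j : ℝ) : ℂ) * w1 j) (by
    intro j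
    rw [norm_mul, hw, mul_one, Complex.norm_real, Real.norm_eq_abs, hxs])
  refine ⟨A, K, hA, hAn, ?_, opNorm_le_one hKn⟩
  intro i j
  rw [hK, hA, coord_smul, coord_smul, coord_delta]
  split_ifs with h
  · rw [h]; ring
  · simp

theorem exists_A2 {x : ℤ → ℝ} (hx : IsPos x) : ∃ A : Op, (∀ j, A (δ j) = w2 j • δ (s2 j)) ∧
    (∀ ψ, ‖A ψ‖ = ‖ψ‖) ∧ IsXComm x A 0 := by
  have hinj : Function.Injective s2 := Function.LeftInverse.injective s2_s2
  have hw : ∀ j, ‖w2 j‖ = 1 := by intro j; unfold w2; split_ifs <;> simp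
  obtain ⟨A, hA, hAn⟩ := exists_op s2 hinj w2 hw
  refine ⟨A, hA, hAn, IsXComm.diag hA ?_⟩
  intro j
  by_cases h : Even j
  · obtain ⟨a, rfl⟩ := h.two_dvd
    rw [s2_even h, (hx a).1, (hx a).2]
  · obtain ⟨a, rfl⟩ := Int.not_even_iff_odd.mp h
    rw [s2_odd h, (hx a).2, add_sub_cancel_right, (hx a).1]

theorem B_eq {A1 A2 B : Op}
    (hA1 : ∀ j, A1 (δ j) = w1 j • δ (s1 j)) (hA2 : ∀ j, A2 (δ j) = w2 j • δ (s2 j))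
    (hB : IsB B) : B = A1 + A2 := by
  refine op_ext fun j => ?_
  rw [hB, add_apply, hA1, hA2]
  by_cases h : Even j
  · rw [s1_even h, w1_even h, s2_even h, w2_even h]; simp [sub_eq_add_neg]
  · rw [s1_odd h, w1_odd h, s2_odd h, w2_odd h]; simp; abel

theorem C_eq {A1 A2 C : Op}
    (hA1 : ∀ j, A1 (δ j) = w1 j • δ (s1 j)) (hA2 : ∀ j, A2 (δ j) = w2 j • δ (s2 j))
    (hC : IsC C) : C = A1 * A2 := by
  refine op_ext fun j => ?_
  rw [op_mul_apply, hA2, map_smul, hA1]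
  by_cases h : Even j
  · have h' : ¬ Even (j + 1) := by rw [Int.not_even_iff_odd]; exact h.add_one
    rw [s2_even h, w2_even h, s1_odd h', w1_odd h']
    obtain ⟨a, rfl⟩ := h.two_dvd
    rw [(hC a).1, smul_smul, neg_one_mul, neg_neg, one_smul, add_assoc]
    rfl
  · obtain ⟨a, rfl⟩ := Int.not_even_iff_odd.mp h
    rw [s2_odd h, w2_odd h, add_sub_cancel_right, s1_even (even_two_mul a), w1_even (even_two_mul a),
      (hC a).2, one_smul, one_smul]

theorem Ut_factor {r t : ℝ} (hr : r = Real.sqrt (1 - t ^ 2)) {A1 A2 B C : Op}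
    (hA1 : ∀ j, A1 (δ j) = w1 j • δ (s1 j)) (hA2 : ∀ j, A2 (δ j) = w2 j • δ (s2 j))
    (hB : IsB B) (hC : IsC C) :
    Ut t B C = ((r : ℂ) • (1 : Op) + (t : ℂ) • A1) * ((r : ℂ) • (1 : Op) + (t : ℂ) • A2) := by
  rw [Ut, ← hr, B_eq hA1 hA2 hB, C_eq hA1 hA2 hC]
  simp only [add_mul, mul_add, smul_mul_assoc, mul_smul_comm, one_mul, mul_one, smul_smul, smul_add]
  push_cast
  rw [pow_two, pow_two, mul_comm (t : ℂ) (r : ℂ)]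
  abel

theorem Xexp_le {x : ℤ → ℝ} (hx : IsPos x) {A K : Op} (hA : ‖A‖ ≤ 1) (hK : IsXComm x A K)
    {Ψ : Hqw} (hΨ : IsInit Ψ) : 0 ≤ Xexp x (A Ψ) ∧ Xexp x (A Ψ) ≤ ‖K‖ := by
  obtain ⟨hn, a, b, hab⟩ := hΨ
  have hx0 : x 0 = 0 := by simpa using (hx 0).1
  have hx1 : x 1 = 0 := by simpa using (hx 0).2
  have hxn : ∀ j, 0 ≤ x j := by
    intro j
    by_cases h : Even j
    · obtain ⟨c, rfl⟩ := h.two_dvd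
      rw [(hx c).1]; positivity
    · obtain ⟨c, rfl⟩ := Int.not_even_iff_odd.mp h
      rw [(hx c).2]; positivity
  have hc : ∀ i, coord (K Ψ) i = (x i : ℂ) * coord (A Ψ) i := by
    intro i
    rw [hab]
    simp only [map_add, map_smul, coord_add, coord_smul, hK i 0, hK i 1, hx0, hx1, sub_zero]
    ring
  refine ⟨tsum_nonneg fun j => mul_nonneg (hxn j) (by positivity), ?_⟩
  have hs := lp.hasSum_inner (𝕜 := ℂ) (A Ψ) (K Ψ)
  have hs2 := RCLike.hasSum_re ℂ hs
  have heq : Xexp x (A Ψ) = RCLike.re (inner ℂ (A Ψ) (K Ψ)) := by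
    rw [← hs2.tsum_eq, Xexp]
    refine tsum_congr fun i => ?_
    change _ = RCLike.re (inner ℂ (coord (A Ψ) i) (coord (K Ψ) i))
    rw [hc]
    have : inner ℂ (coord (A Ψ) i) ((x i : ℂ) * coord (A Ψ) i) =
        ((x i * ‖coord (A Ψ) i‖ ^ 2 : ℝ) : ℂ) := by
      rw [RCLike.inner_apply]
      have := Complex.mul_conj' (coord (A Ψ) i)
      push_cast
      rw [← this]
      ring
    rw [this]
    simp only [RCLike.re_to_complex, Complex.ofReal_re]
  rw [heq]
  refine (RCLike.re_le_norm _).trans ((norm_inner_le_norm _ _).trans ?_)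
  have h1 : ‖A Ψ‖ ≤ 1 := (A.le_opNorm Ψ).trans (by rw [hn, mul_one]; exact hA)
  have h2 : ‖K Ψ‖ ≤ ‖K‖ := (K.le_opNorm Ψ).trans (by rw [hn, mul_one])
  calc ‖A Ψ‖ * ‖K Ψ‖ ≤ 1 * ‖K‖ := mul_le_mul h1 h2 (norm_nonneg _) zero_le_one
    _ = ‖K‖ := one_mul _

/-- main theorem: for every `n ∈ ℤ⁺`, every admissible `α`,
and `t ∈ [0,1]`, `limsup_N (1/N)‖[X,U_{t,n}^N]‖ ≤ (4t)^n`, and for every unit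
vector `Ψ₀` supported on `span{δ₀,δ₁}` the asymptotic velocity
`limsup_N (1/N)⟨X⟩_{U_{t,n}^N Ψ₀}` is at most `(4t)^n`. -/
theorem stmt4 (n : ℕ) (hn : 0 < n) (α : ℂ) (hα : IsAdmissible n α)
    (t : ℝ) (ht : t ∈ Set.Icc (0 : ℝ) 1)
    (B C D : Op) (hB : IsB B) (hC : IsC C) (hD : IsDn α D)
    (x : ℤ → ℝ) (hx : IsPos x)
    (K : ℕ → Op) (hK : ∀ N : ℕ, IsXComm x ((D * Ut t B C) ^ N) (K N)) :
    Filter.limsup (fun N : ℕ => (1 / (N : ℝ)) * ‖K N‖) Filter.atTop ≤ (4 * t) ^ n ∧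
      ∀ Ψ₀ : Hqw, IsInit Ψ₀ →
        Filter.limsup (fun N : ℕ => (1 / (N : ℝ)) * Xexp x (((D * Ut t B C) ^ N) Ψ₀))
            Filter.atTop ≤ (4 * t) ^ n := by
  classical
  obtain ⟨ht0, ht1⟩ := ht
  obtain ⟨-, κ, -, hgcd, hαe⟩ := hα
  have hprim : IsPrimitiveRoot α n := by
    have := Complex.isPrimitiveRoot_exp_of_coprime κ n hn.ne' hgcd
    rw [hαe]
    convert this using 2
    push_cast
    ring
  have hα1 : ‖α‖ = 1 := by rw [hαe, Complex.norm_exp_ofReal_mul_I]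
  obtain ⟨r, hr⟩ : ∃ r, r = Real.sqrt (1 - t ^ 2) := ⟨_, rfl⟩
  have hr0 : 0 ≤ r := hr ▸ Real.sqrt_nonneg _
  have hrt : r ^ 2 + t ^ 2 = 1 := by
    rw [hr, Real.sq_sqrt (by nlinarith)]; ring
  have hr1 : r ≤ 1 := by nlinarith
  obtain ⟨A1, K1, hA1, hA1n, hK1, hK1b⟩ := exists_A1 hx
  obtain ⟨A2, hA2, hA2n, hK2⟩ := exists_A2 hx
  have hDn : ∀ ψ, ‖D ψ‖ = ‖ψ‖ := by
    obtain ⟨D', hD', hD'n⟩ := exists_op id Function.injective_id (fun j => α ^ j) (by simp [hα1])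
    have : D = D' := op_ext fun j => by rw [hD, hD']; rfl
    rw [this]; exact hD'n
  have hDK : IsXComm x D 0 := IsXComm.diag (σ := id) (fun j => hD j) (by simp)
  have hU := Ut_factor hr hA1 hA2 hB hC
  set W := D * Ut t B C with hW
  have hWn : ∀ ψ, ‖W ψ‖ = ‖ψ‖ := by
    intro ψ
    rw [hW, hU, op_mul_apply, hDn, op_mul_apply, lin_isom hrt hA1n (sq_neg_one1 hA1),
      lin_isom hrt hA2n (sq_neg_one2 hA2)]
  have hWN : ∀ N : ℕ, ‖W ^ N‖ ≤ 1 := by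
    intro N
    refine opNorm_le_one ?_
    induction N with
    | zero => intro ψ; simp
    | succ N ih => intro ψ; rw [pow_succ, op_mul_apply, ih, hWn]
  have hsub : Subadditive (fun N => ‖K N‖) := by
    intro a b
    have h1 := (hK a).mul (hK b)
    rw [← pow_add] at h1
    change ‖K (a + b)‖ ≤ ‖K a‖ + ‖K b‖
    rw [(hK (a + b)).unique h1]
    refine (norm_add_le _ _).trans (add_le_add ?_ ?_)
    · exact (norm_mul_le _ _).trans (mul_le_of_le_one_right (norm_nonneg _) (hWN b))
    · exact (norm_mul_le _ _).trans (mul_le_of_le_one_left (norm_nonneg _) (hWN a))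
  have hbdd : BddBelow (Set.range fun N : ℕ => ‖K N‖ / (N : ℝ)) := by
    refine ⟨0, ?_⟩
    rintro _ ⟨N, rfl⟩
    positivity
  have htend := hsub.tendsto_lim hbdd
  -- the polynomial
  set Y := monomial 0 D * (lin r t A1 * lin r t A2) with hY
  have hevY : ev Y = W := by
    rw [hY, map_mul, map_mul, ev_lin, ev_lin, ev_monomial, hW, hU]
  have hMD : Maj x t (monomial 0 D) 1 0 := by
    intro k
    rcases k with _ | k
    · rw [coeff_monomial, if_pos rfl]
      exact ⟨by simpa using opNorm_le_one hDn, 0, hDK, by simp⟩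
    · rw [coeff_monomial, if_neg (by simp)]
      exact ⟨by simp [coeff_one], 0, IsXComm.zero, by simp⟩
  have hMY := hMD.mul ((lin_Maj hr0 hr1 ht0 (opNorm_le_one hA1n) hK1 hK1b).mul
    (lin_Maj hr0 hr1 ht0 (opNorm_le_one hA2n) hK2 (b := 0) (by simp)))
  rw [← hY] at hMY
  have hp : (1 * ((1 + X) * (1 + X)) : ℝ[X]) = (1 + X) ^ 2 := by ring
  have hq : (0 * ((1 + X) * (1 + X)) + 1 * (Polynomial.C 1 * X * (1 + X) + (1 + X) * (Polynomial.C 0 * X)) : ℝ[X])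
      = X * (1 + X) := by simp
  rw [hp, hq] at hMY
  have hNN1 : NN (1 + X) := NN.one.add NN.X
  have hNNq : NN (X * (1 + X)) := NN.X.mul hNN1
  have hlim : hsub.lim ≤ (4 * t) ^ n := by
    by_cases ht4 : 1 ≤ 4 * t
    · refine (hsub.lim_le_div hbdd one_ne_zero).trans ?_
      have h1 := comm_bound_s4 hMY hNNq ht0 ht1 1 ?_ (K := K 1) (by
        rw [hevY]; simpa using hK 1)
      · simp at h1 ⊢
        have h2 : 4 * t ≤ (4 * t) ^ n := le_self_pow₀ ht4 hn.ne'
        linarith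
      · intro k hk
        obtain rfl : k = 0 := by omega
        obtain ⟨-, K0, hK0, hb0⟩ := hMY 0
        have : K0 = 0 := by simpa using hb0
        rwa [this] at hK0
    · have hrne : r ≠ 0 := by
        rintro rfl
        push Not at ht4
        nlinarith
      have hbY : PBand Y := by
        refine PBand.mul ?_ (PBand.mul (lin_PBand (Band.perm hA1 ?_)) (lin_PBand (Band.perm hA2 ?_)))
        · intro k
          rw [coeff_monomial]
          split_ifs with h
          · exact Band.perm (σ := id) (fun j => hD j) (by simp)
          · exact Band.zero
        · intro j; unfold s1; split_ifs <;> simp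
        · intro j; unfold s2; split_ifs <;> simp
      have h1 := comm_bound_s4 (hMY.pow n) (((NN.C (Nat.cast_nonneg n)).mul ((hNN1.pow 2).pow (n - 1))).mul hNNq)
        ht0 ht1 n
        (fun k hk => by
          obtain ⟨c, hc⟩ := scalar_coeff hprim hα1 hrne hA1 hA2 hD (hbY.pow n) k hk
          rw [hc]
          exact IsXComm.diag (σ := id) (w := fun _ => c) (fun j => rfl) (by simp)) (K := K n) (by
          rw [map_pow, hevY]; exact hK n)
      refine (hsub.lim_le_div hbdd hn.ne').trans ?_
      rw [div_le_iff₀ (by exact_mod_cast hn)]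
      refine h1.trans ?_
      simp
      have h4 : ((1 + 1 : ℝ) ^ 2) ^ (n - 1) * (1 + 1) ≤ 4 ^ n := by
        obtain ⟨m, rfl⟩ : ∃ m, n = m + 1 := ⟨n - 1, by omega⟩
        rw [Nat.add_sub_cancel, pow_succ (4 : ℝ) m]
        norm_num
      calc t ^ n * (n * ((1 + 1 : ℝ) ^ 2) ^ (n - 1) * (1 + 1))
          = n * t ^ n * (((1 + 1 : ℝ) ^ 2) ^ (n - 1) * (1 + 1)) := by ring
        _ ≤ n * t ^ n * 4 ^ n := by gcongr
        _ = (4 * t) ^ n * n := by rw [mul_pow]; ring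
  have hfun : (fun N : ℕ => (1 / (N : ℝ)) * ‖K N‖) = fun N : ℕ => ‖K N‖ / (N : ℝ) := by
    funext N; ring
  have hls : Filter.limsup (fun N : ℕ => (1 / (N : ℝ)) * ‖K N‖) Filter.atTop ≤ (4 * t) ^ n := by
    rw [hfun, htend.limsup_eq]; exact hlim
  refine ⟨hls, fun Ψ₀ hΨ => le_trans ?_ hls⟩
  have hXX := fun N => Xexp_le hx (hWN N) (hK N) hΨ
  refine Filter.limsup_le_limsup (Filter.Eventually.of_forall fun N => ?_) ?_ ?_
  · exact mul_le_mul_of_nonneg_left (hXX N).2 (by positivity)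
  · refine Filter.IsCoboundedUnder.of_frequently_ge (a := 0) (Filter.Frequently.of_forall fun N => ?_)
    exact mul_nonneg (by positivity) (hXX N).1
  · rw [hfun]; exact htend.isBoundedUnder_le
end
end
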